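/- The number of well-labelled positive paths of size n with exactly k horizontal steps equals C(n,k)·C(n-1,k)·k!·[(n-k-1)!!]² if n-k is even, and C(n,k)·C(n-1,k)·k!·(n-k)!!·(n-k-2)!! if n-k is odd. -/

import Mathlib

/-- The steps of the word are letters in `{-1,0,+1}`. -/
def StepsOK (n : ℕ) (p : Fin (n - 1) → ℤ) : Prop :=
  ∀ i, p i = -1 ∨ p i = 0 ∨ p i = 1

/-- Compatibility between the word and the permutation: a `-1` step forces an ascent
of the labels and a `+1` step forces a descent. -/
def Compat (n : ℕ) (p : Fin (n - 1) → ℤ) (σ : Equiv.Perm (Fin n)) : Prop :=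
  ∀ i : Fin (n - 1),
    (p i = -1 → σ ⟨i.1, by have := i.isLt; omega⟩ < σ ⟨i.1 + 1, by have := i.isLt; omega⟩) ∧
    (p i = 1 → σ ⟨i.1 + 1, by have := i.isLt; omega⟩ < σ ⟨i.1, by have := i.isLt; omega⟩)

/-- Partial sum `p 1 + ... + p j` of the word. -/
def psum (n : ℕ) (p : Fin (n - 1) → ℤ) (j : ℕ) : ℤ :=
  ∑ i ∈ Finset.univ.filter (fun i : Fin (n - 1) => i.1 < j), p i

/-- Well-labelled positive path of size `n`. -/
def IsPositivePath (n : ℕ) (p : Fin (n - 1) → ℤ) (σ : Equiv.Perm (Fin n)) : Prop :=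
  StepsOK n p ∧ Compat n p σ ∧ ∀ j ≤ n - 1, 0 ≤ psum n p j

/-- Well-labelled Motzkin path of size `n`. -/
def IsMotzkinPath (n : ℕ) (p : Fin (n - 1) → ℤ) (σ : Equiv.Perm (Fin n)) : Prop :=
  StepsOK n p ∧ Compat n p σ ∧ (∀ j ≤ n - 2, 0 ≤ psum n p j) ∧ psum n p (n - 1) = -1

/-- Number of well-labelled Motzkin paths of size `n`. -/
noncomputable def motzkinCount (n : ℕ) : ℕ :=
  Nat.card {ps : (Fin (n - 1) → ℤ) × Equiv.Perm (Fin n) // IsMotzkinPath n ps.1 ps.2}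

/-- Number of well-labelled positive paths of size `n`. -/
noncomputable def positiveCount (n : ℕ) : ℕ :=
  Nat.card {ps : (Fin (n - 1) → ℤ) × Equiv.Perm (Fin n) // IsPositivePath n ps.1 ps.2}

/-- Number of horizontal steps (letters `0`) of a word. -/
def horizCount (n : ℕ) (p : Fin (n - 1) → ℤ) : ℕ :=
  (Finset.univ.filter (fun i => p i = 0)).card

/-- The closed form without horizontal steps. -/
def pathNum (m : ℕ) : ℕ :=
  if Even m then Nat.doubleFactorial (m - 1) ^ 2
  else Nat.doubleFactorial m * Nat.doubleFactorial (m - 2)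

lemma pathNum_succ_of_even {m : ℕ} (h : Even m) : pathNum (m + 1) = (m + 1) * pathNum m := by
  have h' : ¬ Even (m + 1) := by simpa [Nat.even_add_one] using h
  rw [pathNum, pathNum, if_pos h, if_neg h', Nat.doubleFactorial_add_one]
  have : m + 1 - 2 = m - 1 := by omega
  rw [this]; ring

lemma pathNum_succ_of_odd {m : ℕ} (h : ¬ Even m) : pathNum (m + 1) = m * pathNum m := by
  have h' : Even (m + 1) := by simpa [Nat.even_add_one] using h
  rw [pathNum, pathNum, if_neg h, if_pos h', Nat.add_sub_cancel]
  obtain ⟨r, rfl⟩ : ∃ r, m = r + 1 := ⟨m - 1, by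
    rcases m with _ | m
    · simp at h
    · simp⟩
  rw [Nat.doubleFactorial_add_one]
  have : r + 1 - 2 = r - 1 := by omega
  rw [this]; ring

/-- The exponential coefficients of `pathNum`. -/
noncomputable def pathCoeff (m : ℕ) : ℚ := pathNum m / m.factorial

lemma pathCoeff_succ_of_even {m : ℕ} (h : Even m) : pathCoeff (m + 1) = pathCoeff m := by
  rw [pathCoeff, pathCoeff, pathNum_succ_of_even h, Nat.factorial_succ]
  push_cast
  have : (m.factorial : ℚ) ≠ 0 := by exact_mod_cast m.factorial_ne_zero
  field_simp

lemma pathCoeff_succ_of_odd {m : ℕ} (h : ¬ Even m) :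
    (m + 1) * pathCoeff (m + 1) = m * pathCoeff m := by
  rw [pathCoeff, pathCoeff, pathNum_succ_of_odd h, Nat.factorial_succ]
  push_cast
  have : (m.factorial : ℚ) ≠ 0 := by exact_mod_cast m.factorial_ne_zero
  field_simp

lemma pathCoeff_zero : pathCoeff 0 = 1 := by simp [pathCoeff, pathNum]

lemma pathCoeff_one : pathCoeff 1 = 1 := by
  simpa [pathCoeff_zero] using pathCoeff_succ_of_even (m := 0) (by simp)

lemma pathCoeff_recurrence (m : ℕ) :
    (m + 2) * pathCoeff (m + 2) = pathCoeff (m + 1) + m * pathCoeff m := by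
  by_cases h : Even m
  · have h' : ¬ Even (m + 1) := by simpa [Nat.even_add_one] using h
    have h1 := pathCoeff_succ_of_even h
    have h2 := pathCoeff_succ_of_odd h'
    push_cast at h2
    linear_combination h2 + m * h1
  · have h' : Even (m + 1) := by simpa [Nat.even_add_one] using h
    have h1 := pathCoeff_succ_of_odd h
    have h2 := pathCoeff_succ_of_even h'
    linear_combination h1 + (m + 2) * h2

open PowerSeries in
lemma sum_pathCoeff_mul (m : ℕ) :
    ∑ x ∈ Finset.HasAntidiagonal.antidiagonal (m + 1), pathCoeff x.1 * pathCoeff x.2 = 2 := by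
  set E : ℚ⟦X⟧ := PowerSeries.mk pathCoeff with hE
  have hode : d⁄dX ℚ E = E + X ^ 2 * d⁄dX ℚ E := by
    ext n
    rw [map_add, coeff_derivative, coeff_X_pow_mul', hE, coeff_mk, coeff_mk]
    rcases n with _ | _ | n
    · simp [pathCoeff_zero, pathCoeff_one]
    · have := pathCoeff_recurrence 0
      simp at this ⊢
      linear_combination this
    · have := pathCoeff_recurrence (n + 1)
      simp [coeff_derivative] at this ⊢
      linear_combination this
  have hode2 : d⁄dX ℚ (E * E) = C 2 * (E * E) + X ^ 2 * d⁄dX ℚ (E * E) := by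
    have h2 : (C 2 : ℚ⟦X⟧) = 2 := map_ofNat _ 2
    rw [Derivation.leibniz, smul_eq_mul, h2]
    linear_combination 2 * E * hode
  have hc : ∀ n, coeff n (E * E) =
      ∑ x ∈ Finset.HasAntidiagonal.antidiagonal n, pathCoeff x.1 * pathCoeff x.2 := by
    intro n; rw [coeff_mul]; simp [hE]
  rw [← hc]
  have h0 : coeff 0 (E * E) = 1 := by rw [hc]; simp [pathCoeff_zero]
  have hrec : ∀ n, coeff (n + 1) (E * E) * (n + 1) = 2 * coeff n (E * E) +
      if 2 ≤ n then coeff (n - 2 + 1) (E * E) * ((n - 2 : ℕ) + 1) else 0 := by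
    intro n
    have := congrArg (coeff n) hode2
    rwa [map_add, coeff_derivative, coeff_X_pow_mul', coeff_C_mul, coeff_derivative] at this
  induction m using Nat.strong_induction_on with
  | _ m ih =>
    have hr := hrec m
    rcases m with _ | _ | m
    · simpa [h0] using hr
    · rw [ih 0 (by omega)] at hr
      norm_num at hr ⊢
      linarith
    · rw [ih (m + 1) (by omega), if_pos (by omega),
        show m + 1 + 1 - 2 = m by omega, ih m (by omega)] at hr
      push_cast at hr
      have : (0 : ℚ) < m + 1 + 1 + 1 := by positivity
      have h3 : (coeff (m + 1 + 1 + 1) (E * E) - 2) * ((m : ℚ) + 1 + 1 + 1) = 0 := by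
        linear_combination hr
      rcases mul_eq_zero.1 h3 with h | h
      · linarith
      · exact absurd h this.ne'

lemma sum_choose_mul_choose (a b k : ℕ) :
    ∑ y ∈ Finset.HasAntidiagonal.antidiagonal k, ((a + y.1 - 1).choose y.1 * (b + y.2 - 1).choose y.2 : ℚ) =
      ((a + b + k - 1).choose k : ℚ) := by
  have hcoeff : ∀ d n, PowerSeries.coeff n (PowerSeries.invOneSubPow ℚ d).val =
      ((d + n - 1).choose n : ℚ) := by
    intro d n
    rcases d with _ | d
    · rw [PowerSeries.invOneSubPow_zero]
      rcases n with _ | n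
      · simp
      · simp [PowerSeries.coeff_one]
    · rw [PowerSeries.invOneSubPow_val_succ_eq_mk_add_choose, PowerSeries.coeff_mk]
      have : d + 1 + n - 1 = d + n := by omega
      rw [this, Nat.choose_symm_add]
  have h := congrArg (fun u : (PowerSeries ℚ)ˣ => PowerSeries.coeff k u.val)
    (PowerSeries.invOneSubPow_add ℚ a b)
  simp only [Units.val_mul, PowerSeries.coeff_mul, hcoeff] at h
  exact h.symm

/-- The normalised closed form with horizontal steps. -/
noncomputable def horizCoeff (n k : ℕ) : ℚ := (n - 1).choose k * pathCoeff (n - k)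

lemma horizCoeff_of_lt {n k : ℕ} (h : n < k) : horizCoeff n k = 0 := by
  rw [horizCoeff, Nat.choose_eq_zero_of_lt (by omega)]; simp

lemma horizCoeff_add (m k : ℕ) :
    horizCoeff (m + k) k = (m + k - 1).choose k * pathCoeff m := by
  rw [horizCoeff, Nat.add_sub_cancel]

lemma sum_horizCoeff_mul_shift (m a b : ℕ) :
    ∑ x ∈ Finset.HasAntidiagonal.antidiagonal (m + (a + b)), horizCoeff x.1 a * horizCoeff x.2 b =
      ∑ x ∈ Finset.HasAntidiagonal.antidiagonal m, horizCoeff (x.1 + a) a * horizCoeff (x.2 + b) b := by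
  symm
  apply Finset.sum_of_injOn (fun x => (x.1 + a, x.2 + b))
  · rintro ⟨x, y⟩ _ ⟨x', y'⟩ _ h
    simpa using h
  · rintro ⟨x, y⟩ h
    simp at h ⊢
    omega
  · rintro ⟨x, y⟩ h h'
    simp at h h' ⊢
    by_contra! hc
    have h1 : a ≤ x := by
      by_contra! hx; exact hc.1 (horizCoeff_of_lt hx)
    have h2 : b ≤ y := by
      by_contra! hx; exact hc.2 (horizCoeff_of_lt hx)
    exact h' (x - a) (y - b) (by omega) (by omega) (by omega)
  · simp

lemma sum_horizCoeff_mul (n k : ℕ) (hn : 0 < n) :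
    ∑ x ∈ Finset.HasAntidiagonal.antidiagonal n, ∑ y ∈ Finset.HasAntidiagonal.antidiagonal k,
      horizCoeff x.1 y.1 * horizCoeff x.2 y.2 = 2 * (n - 1).choose k := by
  rw [Finset.sum_comm]
  rcases lt_or_ge n k with hk | hk
  · rw [Nat.choose_eq_zero_of_lt (by omega)]
    simp only [Nat.cast_zero, mul_zero]
    refine Finset.sum_eq_zero fun y hy => Finset.sum_eq_zero fun x hx => ?_
    rw [Finset.HasAntidiagonal.mem_antidiagonal] at hx hy
    rcases lt_or_ge x.1 y.1 with h | h
    · rw [horizCoeff_of_lt h, zero_mul]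
    · rw [horizCoeff_of_lt (show x.2 < y.2 by omega), mul_zero]
  · obtain ⟨m, rfl⟩ : ∃ m, n = m + k := ⟨n - k, by omega⟩
    have h1 : ∀ y ∈ Finset.HasAntidiagonal.antidiagonal k,
        ∑ x ∈ Finset.HasAntidiagonal.antidiagonal (m + k), horizCoeff x.1 y.1 * horizCoeff x.2 y.2 =
        ∑ x ∈ Finset.HasAntidiagonal.antidiagonal m, pathCoeff x.1 * pathCoeff x.2 *
          ((x.1 + y.1 - 1).choose y.1 * (x.2 + y.2 - 1).choose y.2 : ℚ) := by
      intro y hy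
      rw [← Finset.HasAntidiagonal.mem_antidiagonal.1 hy, sum_horizCoeff_mul_shift]
      refine Finset.sum_congr rfl fun x _ => ?_
      rw [horizCoeff_add, horizCoeff_add]; ring
    rw [Finset.sum_congr rfl h1, Finset.sum_comm]
    have h2 : ∀ x ∈ Finset.HasAntidiagonal.antidiagonal m, ∑ y ∈ Finset.HasAntidiagonal.antidiagonal k,
        pathCoeff x.1 * pathCoeff x.2 *
          ((x.1 + y.1 - 1).choose y.1 * (x.2 + y.2 - 1).choose y.2 : ℚ) =
        pathCoeff x.1 * pathCoeff x.2 * (m + k - 1).choose k := by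
      intro x hx
      rw [← Finset.mul_sum, sum_choose_mul_choose, Finset.HasAntidiagonal.mem_antidiagonal.1 hx]
    rw [Finset.sum_congr rfl h2, ← Finset.sum_mul]
    rcases m with _ | m
    · rw [Nat.choose_eq_zero_of_lt (show 0 + k - 1 < k by omega)]; simp
    · rw [sum_pathCoeff_mul]

/-- A doubly indexed rational array is determined by its convolution square and the sign of its
first entry. -/
lemma eq_of_convolution_square_eq (f g : ℕ → ℕ → ℚ) (h0 : f 0 0 = 1) (h0' : g 0 0 = 1)
    (h : ∀ n k, ∑ x ∈ Finset.HasAntidiagonal.antidiagonal n, ∑ y ∈ Finset.HasAntidiagonal.antidiagonal k,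
        f x.1 y.1 * f x.2 y.2 =
      ∑ x ∈ Finset.HasAntidiagonal.antidiagonal n, ∑ y ∈ Finset.HasAntidiagonal.antidiagonal k, g x.1 y.1 * g x.2 y.2)
    (n k : ℕ) : f n k = g n k := by
  let P : (ℕ → ℕ → ℚ) → PowerSeries (PowerSeries ℚ) := fun f =>
    PowerSeries.mk fun n => PowerSeries.mk (f n)
  have hP : ∀ f n k, PowerSeries.coeff k (PowerSeries.coeff n (P f)) = f n k := by
    intro f n k; simp [P]
  have hsq : P f * P f = P g * P g := by
    ext n k
    simp only [PowerSeries.coeff_mul, map_sum, hP]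
    exact h n k
  rcases mul_self_eq_mul_self_iff.1 hsq with h1 | h1
  · rw [← hP f, h1, hP]
  · have := hP f 0 0
    rw [h1, map_neg, map_neg, hP, h0, h0'] at this
    norm_num at this

/-- The step joining two consecutive vertices, each given by a flag (which says whether the step
after it is horizontal) and a label. -/
def stepOf (x y : Bool × ℕ) : ℤ := if x.1 then 0 else if x.2 < y.2 then -1 else 1

/-- The height of the vertex number `j` of a word, relative to its first vertex. -/
def height (l : List (Bool × ℕ)) (j : ℕ) : ℤ :=
  ∑ i ∈ Finset.range j, stepOf (l.getD i (false, 0)) (l.getD (i + 1) (false, 0))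

/-- Words with label set `S` and `k` horizontal steps; the last flag is a dummy. -/
structure IsWord (S : Finset ℕ) (k : ℕ) (l : List (Bool × ℕ)) : Prop where
  nodup : (l.map Prod.snd).Nodup
  labels : (l.map Prod.snd).toFinset = S
  last : (l.getD (l.length - 1) (false, 0)).1 = false
  count : l.countP Prod.fst = k

/-- No vertex is lower than the first one. -/
def StaysAboveStart (l : List (Bool × ℕ)) : Prop := ∀ j < l.length, 0 ≤ height l j

/-- No vertex is lower than the last one. -/
def StaysAboveEnd (l : List (Bool × ℕ)) : Prop :=
  ∀ j < l.length, height l (l.length - 1) ≤ height l j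

lemma IsWord.length_eq {S : Finset ℕ} {k : ℕ} {l : List (Bool × ℕ)} (h : IsWord S k l) :
    l.length = S.card := by
  rw [← h.labels, List.toFinset_card_of_nodup h.nodup, List.length_map]

lemma height_succ (l : List (Bool × ℕ)) (j : ℕ) : height l (j + 1) =
    height l j + stepOf (l.getD j (false, 0)) (l.getD (j + 1) (false, 0)) :=
  Finset.sum_range_succ _ _

/-- Well-labelled paths with `k` horizontal steps and no positivity condition. -/
def IsPath (n k : ℕ) (ps : (Fin (n - 1) → ℤ) × Equiv.Perm (Fin n)) : Prop :=
  StepsOK n ps.1 ∧ Compat n ps.1 ps.2 ∧ horizCount n ps.1 = k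

lemma psum_eq_sum_range (n : ℕ) (p : Fin (n - 1) → ℤ) (j : ℕ) (hj : j ≤ n - 1) :
    psum n p j = ∑ i ∈ Finset.range j, if h : i < n - 1 then p ⟨i, h⟩ else 0 := by
  have h1 : psum n p j = ∑ i : Fin (n - 1), (fun i : ℕ =>
      if i < j then (if h : i < n - 1 then p ⟨i, h⟩ else 0) else 0) i := by
    rw [psum, Finset.sum_filter]
    exact Finset.sum_congr rfl fun i _ => by simp
  rw [h1, Fin.sum_univ_eq_sum_range (fun i : ℕ =>
    if i < j then (if h : i < n - 1 then p ⟨i, h⟩ else 0) else 0), ← Finset.sum_filter]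
  congr 1
  ext i
  simp
  omega

/-- The word of a path, relabelled by the elements of `S`. -/
def wordOfPath {n : ℕ} (S : Finset ℕ) (hS : S.card = n)
    (ps : (Fin (n - 1) → ℤ) × Equiv.Perm (Fin n)) : List (Bool × ℕ) :=
  List.ofFn fun v : Fin n =>
    (decide (∃ h : v.1 < n - 1, ps.1 ⟨v.1, h⟩ = 0), S.orderEmbOfFin hS (ps.2 v))

lemma getD_wordOfPath {n : ℕ} (S : Finset ℕ) (hS : S.card = n)
    (ps : (Fin (n - 1) → ℤ) × Equiv.Perm (Fin n)) (i : ℕ) (hi : i < n) :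
    (wordOfPath S hS ps).getD i (false, 0) =
      (decide (∃ h : i < n - 1, ps.1 ⟨i, h⟩ = 0), S.orderEmbOfFin hS (ps.2 ⟨i, hi⟩)) := by
  rw [List.getD_eq_getElem _ _ (by simpa [wordOfPath] using hi)]
  simp [wordOfPath]

lemma stepOf_wordOfPath {n k : ℕ} (S : Finset ℕ) (hS : S.card = n)
    {ps : (Fin (n - 1) → ℤ) × Equiv.Perm (Fin n)} (h : IsPath n k ps) (i : ℕ) (hi : i < n - 1) :
    stepOf ((wordOfPath S hS ps).getD i (false, 0)) ((wordOfPath S hS ps).getD (i + 1) (false, 0)) =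
      ps.1 ⟨i, hi⟩ := by
  obtain ⟨h1, h2, -⟩ := h
  rw [getD_wordOfPath _ _ _ _ (by omega), getD_wordOfPath _ _ _ _ (by omega), stepOf]
  have hc := h2 ⟨i, hi⟩
  rcases h1 ⟨i, hi⟩ with h0 | h0 | h0
  · have := hc.1 h0
    simp [h0, this]
  · simp [h0, hi]
  · have := hc.2 h0
    simp [h0, this.le]

lemma height_wordOfPath {n k : ℕ} (S : Finset ℕ) (hS : S.card = n)
    {ps : (Fin (n - 1) → ℤ) × Equiv.Perm (Fin n)} (h : IsPath n k ps) (j : ℕ) (hj : j ≤ n - 1) :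
    height (wordOfPath S hS ps) j = psum n ps.1 j := by
  rw [psum_eq_sum_range _ _ _ hj, height]
  refine Finset.sum_congr rfl fun i hi => ?_
  have hi' : i < n - 1 := by have := Finset.mem_range.1 hi; omega
  rw [stepOf_wordOfPath S hS h i hi', dif_pos hi']

lemma isWord_wordOfPath {n k : ℕ} (S : Finset ℕ) (hS : S.card = n)
    {ps : (Fin (n - 1) → ℤ) × Equiv.Perm (Fin n)} (h : IsPath n k ps) :
    IsWord S k (wordOfPath S hS ps) where
  nodup := by
    rw [wordOfPath, List.map_ofFn, List.nodup_ofFn]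
    exact (S.orderEmbOfFin hS).injective.comp ps.2.injective
  labels := by
    ext x
    have := Set.ext_iff.1 (S.range_orderEmbOfFin hS) x
    simp only [Set.mem_range, SetLike.mem_coe] at this
    rw [List.mem_toFinset, wordOfPath, List.map_ofFn, List.mem_ofFn', ← this]
    constructor
    · rintro ⟨i, rfl⟩; exact ⟨ps.2 i, rfl⟩
    · rintro ⟨i, rfl⟩; exact ⟨ps.2.symm i, by simp⟩
  last := by
    rcases Nat.eq_zero_or_pos n with h0 | h0
    · subst h0; simp [wordOfPath]
    · have hl : (wordOfPath S hS ps).length = n := by simp [wordOfPath]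
      rw [hl, getD_wordOfPath _ _ _ _ (by omega)]
      simp
  count := by
    have h1 : (wordOfPath S hS ps).countP Prod.fst =
        (Finset.univ.filter fun v : Fin n => ∃ h : v.1 < n - 1, ps.1 ⟨v.1, h⟩ = 0).card := by
      rw [wordOfPath, List.ofFn_eq_map, List.countP_map, Finset.card_def, Finset.filter_val,
        ← Multiset.countP_eq_card_filter]
      rfl
    rw [h1, ← h.2.2, horizCount]
    symm
    refine Finset.card_bij (fun i _ => ⟨i.1, by omega⟩) ?_ ?_ ?_
    · intro i hi
      simpa using hi
    · intro i _ j _ hij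
      simpa [Fin.ext_iff] using hij
    · intro v hv
      obtain ⟨h, hv⟩ := (Finset.mem_filter.1 hv).2
      exact ⟨⟨v.1, h⟩, by simpa using hv, rfl⟩

lemma wordOfPath_injective {n k : ℕ} (S : Finset ℕ) (hS : S.card = n)
    {ps qs : (Fin (n - 1) → ℤ) × Equiv.Perm (Fin n)} (h : IsPath n k ps) (h' : IsPath n k qs)
    (heq : wordOfPath S hS ps = wordOfPath S hS qs) : ps = qs := by
  refine Prod.ext ?_ ?_
  · ext ⟨i, hi⟩
    rw [← stepOf_wordOfPath S hS h, heq, stepOf_wordOfPath S hS h']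
  · refine Equiv.ext fun ⟨i, hi⟩ => ?_
    have := getD_wordOfPath S hS ps i hi
    rw [heq, getD_wordOfPath S hS qs i hi, Prod.mk.injEq] at this
    exact ((S.orderEmbOfFin hS).injective this.2).symm

lemma exists_wordOfPath_eq {n k : ℕ} (S : Finset ℕ) (hS : S.card = n) {l : List (Bool × ℕ)}
    (h : IsWord S k l) : ∃ ps, IsPath n k ps ∧ wordOfPath S hS ps = l := by
  have hl : l.length = n := h.length_eq.trans hS
  have hmem : ∀ v : Fin n, (l[v.1]'(by omega)).2 ∈ S := by
    intro v
    rw [← h.labels, List.mem_toFinset]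
    exact List.mem_map_of_mem (List.getElem_mem _)
  let f : Fin n → Fin n := fun v => (S.orderIsoOfFin hS).symm ⟨_, hmem v⟩
  have hf : Function.Injective f := by
    intro v w hvw
    have h1 := (S.orderIsoOfFin hS).symm.injective hvw
    rw [Subtype.mk.injEq] at h1
    have h2 := (List.nodup_iff_injective_get.1 h.nodup)
      (a₁ := ⟨v.1, by simp [hl]⟩) (a₂ := ⟨w.1, by simp [hl]⟩) (by simpa using h1)
    simpa [Fin.ext_iff] using h2
  let σ : Equiv.Perm (Fin n) := Equiv.ofBijective f (Finite.injective_iff_bijective.1 hf)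
  have hσ : ∀ v, S.orderEmbOfFin hS (σ v) = (l[v.1]'(by omega)).2 := by
    intro v
    rw [← Finset.coe_orderIsoOfFin_apply]
    simp [σ, f]
  have hlt : ∀ v w, σ v < σ w ↔ (l[v.1]'(by omega)).2 < (l[w.1]'(by omega)).2 := by
    intro v w
    rw [← hσ, ← hσ, OrderEmbedding.lt_iff_lt]
  let p : Fin (n - 1) → ℤ := fun i =>
    stepOf (l[i.1]'(by omega)) (l[i.1 + 1]'(by omega))
  have hp0 : ∀ i, p i = 0 ↔ (l[i.1]'(by omega)).1 = true := by
    intro i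
    simp only [p, stepOf]
    split_ifs <;> simp_all
  have hw : wordOfPath S hS (p, σ) = l := by
    refine List.ext_getElem (by simp [wordOfPath, hl]) fun i hi hi' => ?_
    simp only [wordOfPath, List.getElem_ofFn]
    refine Prod.ext ?_ (hσ _)
    simp only [hp0]
    by_cases hin : i < n - 1
    · simp [hin]
    · have hi2 : i = l.length - 1 := by omega
      have := h.last
      rw [List.getD_eq_getElem _ _ (by omega)] at this
      subst hi2
      simp only [hl] at this
      simp [this, hl]
  have hpath : IsPath n (horizCount n p) (p, σ) := by
    refine ⟨?_, ?_, rfl⟩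
    · intro i
      simp only [p, stepOf]
      split_ifs <;> simp
    · intro i
      simp only [p, stepOf, hlt]
      constructor
      · split_ifs <;> simp_all
      · split_ifs with h1 h2
        · simp
        · simp
        · intro _
          have hne : σ ⟨i.1, by omega⟩ ≠ σ ⟨i.1 + 1, by omega⟩ := by
            intro he
            simpa using σ.injective he
          have h3 := (hlt ⟨i.1, by omega⟩ ⟨i.1 + 1, by omega⟩).not.2 h2
          exact (hlt _ _).1 (lt_of_le_of_ne (not_lt.1 h3) hne.symm)
  refine ⟨(p, σ), ⟨hpath.1, hpath.2.1, ?_⟩, hw⟩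
  have := (isWord_wordOfPath S hS hpath).count
  rw [hw, h.count] at this
  exact this.symm

/-- Paths correspond to words over any label set of the right size. -/
noncomputable def pathEquivWord {n : ℕ} (S : Finset ℕ) (hS : S.card = n) (k : ℕ) :
    {ps // IsPath n k ps} ≃ {l // IsWord S k l} :=
  Equiv.ofBijective (fun ps => ⟨wordOfPath S hS ps.1, isWord_wordOfPath S hS ps.2⟩) <| by
    constructor
    · intro ps qs h
      exact Subtype.ext (wordOfPath_injective S hS ps.2 qs.2 (Subtype.ext_iff.1 h))
    · rintro ⟨l, hl⟩
      obtain ⟨ps, h, rfl⟩ := exists_wordOfPath_eq S hS hl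
      exact ⟨⟨ps, h⟩, rfl⟩

lemma psum_zero (n : ℕ) (p : Fin (n - 1) → ℤ) : psum n p 0 = 0 := by simp [psum]

lemma psum_succ (n : ℕ) (p : Fin (n - 1) → ℤ) (j : ℕ) (hj : j < n - 1) :
    psum n p (j + 1) = psum n p j + p ⟨j, hj⟩ := by
  rw [psum_eq_sum_range _ _ _ hj, psum_eq_sum_range _ _ _ hj.le, Finset.sum_range_succ, dif_pos hj]

/-- A path is determined by the set of its horizontal steps and its labels. -/
noncomputable def pathEquivZeros (n k : ℕ) :
    {ps // IsPath n k ps} ≃ {s : Finset (Fin (n - 1)) // s.card = k} × Equiv.Perm (Fin n) :=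
  Equiv.ofBijective (fun ps => (⟨Finset.univ.filter fun i => ps.1.1 i = 0, ps.2.2.2⟩, ps.1.2)) <| by
    constructor
    · rintro ⟨⟨p, σ⟩, h⟩ ⟨⟨q, τ⟩, h'⟩ heq
      simp only [Prod.mk.injEq, Subtype.mk.injEq] at heq
      obtain ⟨h0, rfl⟩ := heq
      have hz : ∀ i, p i = 0 ↔ q i = 0 := fun i => by
        simpa using Finset.ext_iff.1 h0 i
      refine Subtype.ext (Prod.ext (funext fun i => ?_) rfl)
      have a := h.2.1 i
      have b := h'.2.1 i
      have c := hz i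
      have h1 : p i = -1 ∨ p i = 0 ∨ p i = 1 := h.1 i
      have h2 : q i = -1 ∨ q i = 0 ∨ q i = 1 := h'.1 i
      have h3 : ¬ (p i = -1 ∧ q i = 1) := fun h => (a.1 h.1).not_gt (b.2 h.2)
      have h4 : ¬ (p i = 1 ∧ q i = -1) := fun h => (a.2 h.1).not_gt (b.1 h.2)
      simp only
      omega
    · rintro ⟨⟨s, hs⟩, σ⟩
      let p : Fin (n - 1) → ℤ := fun i => if i ∈ s then 0 else
        if σ ⟨i.1, by omega⟩ < σ ⟨i.1 + 1, by omega⟩ then -1 else 1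
      have hz : ∀ i, p i = 0 ↔ i ∈ s := by
        intro i
        simp only [p]
        split_ifs <;> simp_all
      have hz' : Finset.univ.filter (fun i => p i = 0) = s := by
        ext i; simp [hz]
      refine ⟨⟨(p, σ), ?_, ?_, ?_⟩, ?_⟩
      · intro i
        simp only [p]
        split_ifs <;> simp
      · intro i
        simp only [p]
        constructor
        · split_ifs <;> simp_all
        · split_ifs with h1 h2
          · simp
          · simp
          · intro _
            refine lt_of_le_of_ne (not_lt.1 h2) fun he => ?_
            simpa using σ.injective he
      · rw [horizCount, hz', hs]
      · simp [hz']

instance finite_isPath (n k : ℕ) : Finite {ps // IsPath n k ps} :=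
  Finite.of_equiv _ (pathEquivZeros n k).symm

lemma card_isPath (n k : ℕ) :
    Nat.card {ps // IsPath n k ps} = (n - 1).choose k * n.factorial := by
  rw [Nat.card_congr (pathEquivZeros n k), Nat.card_prod, Nat.card_eq_fintype_card,
    Fintype.card_finset_len, Fintype.card_fin, Nat.card_eq_fintype_card, Fintype.card_perm,
    Fintype.card_fin]

/-- Reading a path backwards. -/
def revPath {n : ℕ} (ps : (Fin (n - 1) → ℤ) × Equiv.Perm (Fin n)) :
    (Fin (n - 1) → ℤ) × Equiv.Perm (Fin n) :=
  (fun i => -ps.1 i.rev, Fin.revPerm.trans ps.2)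

lemma revPath_revPath {n : ℕ} (ps : (Fin (n - 1) → ℤ) × Equiv.Perm (Fin n)) :
    revPath (revPath ps) = ps := by
  refine Prod.ext ?_ ?_
  · ext i; simp [revPath]
  · ext i; simp [revPath]

lemma IsPath.revPath {n k : ℕ} {ps : (Fin (n - 1) → ℤ) × Equiv.Perm (Fin n)}
    (h : IsPath n k ps) : IsPath n k (revPath ps) := by
  obtain ⟨h1, h2, h3⟩ := h
  refine ⟨fun i => ?_, fun i => ?_, ?_⟩
  · have := h1 i.rev
    simp only [_root_.revPath]
    omega
  · have := h2 i.rev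
    have e1 : (⟨i.rev.1, by omega⟩ : Fin n) = Fin.rev ⟨i.1 + 1, by omega⟩ := by
      ext; simp; omega
    have e2 : (⟨i.rev.1 + 1, by omega⟩ : Fin n) = Fin.rev ⟨i.1, by omega⟩ := by
      ext; simp; omega
    rw [e1, e2] at this
    simp only [_root_.revPath, Equiv.trans_apply, Fin.revPerm_apply]
    refine ⟨fun h => this.2 (by omega), fun h => this.1 (by omega)⟩
  · rw [← h3, horizCount, horizCount]
    refine Finset.card_bij (fun i _ => i.rev) ?_ ?_ ?_
    · intro i hi
      simpa [_root_.revPath] using hi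
    · intro i _ j _ hij
      simpa using hij
    · intro i hi
      exact ⟨i.rev, by simpa [_root_.revPath] using hi, by simp⟩

lemma psum_revPath {n : ℕ} (ps : (Fin (n - 1) → ℤ) × Equiv.Perm (Fin n)) (j : ℕ)
    (hj : j ≤ n - 1) :
    psum n (revPath ps).1 j = psum n ps.1 (n - 1 - j) - psum n ps.1 (n - 1) := by
  induction j with
  | zero => simp [psum_zero]
  | succ j ih =>
    rw [psum_succ _ _ _ hj, ih (by omega)]
    obtain ⟨r, hr⟩ : ∃ r, n - 1 - j = r + 1 := ⟨n - 1 - j - 1, by omega⟩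
    have hr' : n - 1 - (j + 1) = r := by omega
    rw [hr, hr', psum_succ n ps.1 r (by omega)]
    have : (Fin.rev ⟨j, hj⟩ : Fin (n - 1)) = ⟨r, by omega⟩ := by
      ext; simp; omega
    simp only [revPath, this]
    ring

/-- The number of positive paths with `k` horizontal steps. -/
noncomputable def positiveHorizCount (n k : ℕ) : ℕ :=
  Nat.card {ps : (Fin (n - 1) → ℤ) × Equiv.Perm (Fin n) //
    IsPositivePath n ps.1 ps.2 ∧ horizCount n ps.1 = k}

/-- `pathEquivWord` restricted to corresponding subsets. -/
noncomputable def pathEquivWordSubtype {n k : ℕ} (S : Finset ℕ) (hS : S.card = n)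
    (Q : (Fin (n - 1) → ℤ) × Equiv.Perm (Fin n) → Prop) (R : List (Bool × ℕ) → Prop)
    (h : ∀ ps, IsPath n k ps → (Q ps ↔ R (wordOfPath S hS ps))) :
    {ps // IsPath n k ps ∧ Q ps} ≃ {l // IsWord S k l ∧ R l} :=
  (Equiv.subtypeSubtypeEquivSubtypeInter _ _).symm.trans <|
    ((pathEquivWord S hS k).subtypeEquiv fun ps => h ps.1 ps.2).trans <|
    Equiv.subtypeSubtypeEquivSubtypeInter _ _

instance finite_isWord (S : Finset ℕ) (k : ℕ) : Finite {l // IsWord S k l} :=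
  Finite.of_equiv _ (pathEquivWord S rfl k)

lemma card_isWord (S : Finset ℕ) (k : ℕ) :
    Nat.card {l // IsWord S k l} = (S.card - 1).choose k * S.card.factorial := by
  rw [← Nat.card_congr (pathEquivWord S rfl k), card_isPath]

lemma length_wordOfPath {n : ℕ} (S : Finset ℕ) (hS : S.card = n)
    (ps : (Fin (n - 1) → ℤ) × Equiv.Perm (Fin n)) : (wordOfPath S hS ps).length = n := by
  simp [wordOfPath]

lemma card_staysAboveStart (S : Finset ℕ) (k : ℕ) :
    Nat.card {l // IsWord S k l ∧ StaysAboveStart l} = positiveHorizCount S.card k := by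
  rw [← Nat.card_congr (pathEquivWordSubtype S rfl
    (fun ps => ∀ j ≤ S.card - 1, 0 ≤ psum S.card ps.1 j) _ ?_), positiveHorizCount]
  · refine Nat.card_congr (Equiv.subtypeEquivRight fun ps => ?_)
    rw [IsPath, IsPositivePath]
    tauto
  · intro ps h
    rw [StaysAboveStart, length_wordOfPath]
    constructor
    · intro hp j hj
      rw [height_wordOfPath S rfl h j (by omega)]
      exact hp j (by omega)
    · intro hp j hj
      rcases Nat.eq_zero_or_pos j with rfl | h0
      · rw [psum_zero]
      · rw [← height_wordOfPath S rfl h j hj]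
        exact hp j (by omega)

lemma card_staysAboveEnd (S : Finset ℕ) (k : ℕ) :
    Nat.card {l // IsWord S k l ∧ StaysAboveEnd l} = positiveHorizCount S.card k := by
  rw [← Nat.card_congr (pathEquivWordSubtype S rfl
    (fun ps => ∀ j ≤ S.card - 1, psum S.card ps.1 (S.card - 1) ≤ psum S.card ps.1 j) _ ?_),
    positiveHorizCount]
  · have hrev : Function.Involutive (revPath (n := S.card)) := revPath_revPath
    refine Nat.card_congr (hrev.toPerm.subtypeEquiv fun ps => ?_)
    simp only [Function.Involutive.coe_toPerm]
    have key : (∀ j ≤ S.card - 1, psum S.card ps.1 (S.card - 1) ≤ psum S.card ps.1 j) ↔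
        ∀ j ≤ S.card - 1, 0 ≤ psum S.card (revPath ps).1 j := by
      constructor
      · intro h j hj
        rw [psum_revPath ps j hj]
        have := h (S.card - 1 - j) (by omega)
        omega
      · intro h j hj
        have := h (S.card - 1 - j) (by omega)
        rw [psum_revPath ps _ (by omega), Nat.sub_sub_self hj] at this
        omega
    rw [key, IsPositivePath]
    constructor
    · rintro ⟨h, h'⟩
      exact ⟨⟨h.revPath.1, h.revPath.2.1, h'⟩, h.revPath.2.2⟩
    · rintro ⟨⟨h1, h2, h3⟩, h4⟩
      refine ⟨?_, h3⟩
      have := IsPath.revPath ⟨h1, h2, h4⟩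
      rwa [revPath_revPath] at this
  · intro ps h
    rw [StaysAboveEnd, length_wordOfPath, height_wordOfPath S rfl h _ le_rfl]
    constructor
    · intro hp j hj
      rw [height_wordOfPath S rfl h j (by omega)]
      exact hp j (by omega)
    · intro hp j hj
      rcases Nat.eq_zero_or_pos S.card with h0 | h0
      · rw [show j = S.card - 1 by omega]
      · rw [← height_wordOfPath S rfl h j hj]
        exact hp j (by omega)

/-- `i` splits the sequence `h 0, …, h (n - 1)` into a part that never goes below its last entry
and a part that never goes below its first entry, with distinct entries around the cut. -/
def IsSplit (h : ℕ → ℤ) (n i : ℕ) : Prop :=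
  i ≤ n ∧ (0 < i → i < n → h i ≠ h (i - 1)) ∧ (∀ j < i, h (i - 1) ≤ h j) ∧
    ∀ j, i ≤ j → j < n → h i ≤ h j

lemma exists_first_min (h : ℕ → ℤ) (n : ℕ) (hn : 0 < n) :
    ∃ a < n, (∀ j < n, h a ≤ h j) ∧ ∀ j < a, h a < h j := by
  obtain ⟨m, hm, hmin⟩ := Finset.exists_min_image (Finset.range n) h ⟨0, by simpa using hn⟩
  have hex : ∃ a, a < n ∧ h a ≤ h m := ⟨m, by simpa using hm, le_rfl⟩
  classical
  obtain ⟨h1, h2⟩ := Nat.find_spec hex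
  refine ⟨Nat.find hex, h1, fun j hj => h2.trans (hmin j (by simpa using hj)), fun j hj => ?_⟩
  have := Nat.find_min hex hj
  have hjn : j < n := by omega
  by_contra! hc
  exact this ⟨hjn, hc.trans h2⟩

lemma exists_last_min (h : ℕ → ℤ) (n : ℕ) (hn : 0 < n) :
    ∃ b < n, (∀ j < n, h b ≤ h j) ∧ ∀ j, b < j → j < n → h b < h j := by
  obtain ⟨a, ha, h1, h2⟩ := exists_first_min (fun i => h (n - 1 - i)) n hn
  refine ⟨n - 1 - a, by omega, fun j hj => ?_, fun j hj hj' => ?_⟩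
  · have := h1 (n - 1 - j) (by omega)
    rwa [show n - 1 - (n - 1 - j) = j by omega] at this
  · have := h2 (n - 1 - j) (by omega)
    rwa [show n - 1 - (n - 1 - j) = j by omega] at this

lemma card_isSplit (h : ℕ → ℤ) (n : ℕ) (hn : 0 < n)
    (hstep : ∀ j, h (j + 1) ≤ h j + 1 ∧ h j ≤ h (j + 1) + 1) :
    Nat.card {i // IsSplit h n i} = 2 := by
  obtain ⟨a, ha, ha1, ha2⟩ := exists_first_min h n hn
  obtain ⟨b, hb, hb1, hb2⟩ := exists_last_min h n hn
  have hab : a ≤ b := by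
    by_contra! hc
    have := ha2 b hc
    have := hb1 a ha
    omega
  have key : ∀ i, IsSplit h n i ↔ i ∈ ({a, b + 1} : Finset ℕ) := by
    intro i
    rw [Finset.mem_insert, Finset.mem_singleton]
    constructor
    · rintro ⟨hi, hne, hl, hr⟩
      rcases Nat.eq_zero_or_pos i with rfl | h0
      · left
        by_contra hc
        have := ha2 0 (by omega)
        have := hr a (by omega) ha
        omega
      · rcases hi.eq_or_lt with rfl | hlt
        · right
          by_contra hc
          have := hb2 (i - 1) (by omega) (by omega)
          have := hl b hb
          omega
        · rcases lt_or_gt_of_ne (hne h0 hlt) with hlt' | hgt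
          · left
            have hmin : ∀ j < n, h i ≤ h j := fun j hj => by
              rcases lt_or_ge j i with hji | hji
              · have := hl j hji; omega
              · exact hr j hji hj
            rcases lt_trichotomy i a with hia | hia | hia
            · have := ha2 i hia; have := hmin a ha; omega
            · exact hia
            · have := hl a hia; have := ha1 i hlt; omega
          · right
            have hmin : ∀ j < n, h (i - 1) ≤ h j := fun j hj => by
              rcases lt_or_ge j i with hji | hji
              · exact hl j hji
              · have := hr j hji hj; omega
            rcases lt_trichotomy (i - 1) b with hia | hia | hia
            · have := hr b (by omega) hb; have := hb1 (i - 1) (by omega); omega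
            · omega
            · have := hb2 (i - 1) hia (by omega); have := hmin b hb; omega
    · rintro (rfl | rfl)
      · refine ⟨ha.le, fun h0 _ => ?_, fun j hj => ?_, fun j _ hj => ha1 j hj⟩
        · exact (ha2 _ (by omega)).ne
        · have h1 := ha2 j hj
          have h2 := hstep (i - 1)
          rw [show i - 1 + 1 = i by omega] at h2
          omega
      · refine ⟨hb, fun _ h0 => (hb2 _ (by omega) h0).ne', fun j hj => hb1 j (by omega),
          fun j hj hjn => ?_⟩
        have h1 := hb2 j (by omega) hjn
        have h2 := hstep b
        omega
  rw [Nat.card_congr (Equiv.subtypeEquivRight key), Nat.card_eq_fintype_card, Fintype.card_coe,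
    Finset.card_pair (by omega)]

lemma height_take (l : List (Bool × ℕ)) (i j : ℕ) (hj : j < i) :
    height (l.take i) j = height l j := by
  refine Finset.sum_congr rfl fun r hr => ?_
  have hr' := Finset.mem_range.1 hr
  simp only [List.getD_eq_getElem?_getD, List.getElem?_take]
  rw [if_pos (by omega), if_pos (by omega)]

lemma height_drop (l : List (Bool × ℕ)) (i j : ℕ) :
    height (l.drop i) j = height l (i + j) - height l i := by
  rw [height, height, height, Finset.sum_range_add, add_sub_cancel_left]
  simp only [List.getD_eq_getElem?_getD, List.getElem?_drop, add_assoc]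

lemma height_step (l : List (Bool × ℕ)) (j : ℕ) :
    height l (j + 1) ≤ height l j + 1 ∧ height l j ≤ height l (j + 1) + 1 := by
  rw [height_succ, stepOf]
  split_ifs <;> omega

lemma height_succ_ne_iff (l : List (Bool × ℕ)) (j : ℕ) :
    height l (j + 1) ≠ height l j ↔ (l.getD j (false, 0)).1 = false := by
  rw [height_succ, stepOf]
  split_ifs with h1 h2
  · simp only [h1]; simp
  · simp only [h1]; simp
  · simp only [h1]; simp

/-- The first part of a word cut at `i` never goes below its last vertex, the second one never
goes below its first vertex, and the step across the cut is not horizontal. -/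
def IsCut (l₁ l₂ : List (Bool × ℕ)) : Prop :=
  (l₁.getD (l₁.length - 1) (false, 0)).1 = false ∧ StaysAboveEnd l₁ ∧ StaysAboveStart l₂

lemma isCut_iff_isSplit {S : Finset ℕ} {k : ℕ} {l : List (Bool × ℕ)} (hl : IsWord S k l) (i : ℕ) :
    (i ≤ l.length ∧ IsCut (l.take i) (l.drop i)) ↔ IsSplit (height l) l.length i := by
  rw [IsSplit, and_congr_right_iff]
  intro hi
  have hlen : (l.take i).length = i := by simp [hi]
  refine and_congr ?_ (and_congr ?_ ?_)
  · rw [hlen]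
    rcases Nat.eq_zero_or_pos i with rfl | h0
    · simp
    · have hget : (l.take i).getD (i - 1) (false, 0) = l.getD (i - 1) (false, 0) := by
        simp only [List.getD_eq_getElem?_getD, List.getElem?_take]
        rw [if_pos (by omega)]
      rw [hget]
      rcases hi.eq_or_lt with heq | hlt
      · subst heq
        simpa using hl.last
      · have := height_succ_ne_iff l (i - 1)
        rw [Nat.sub_add_cancel h0] at this
        rw [← this]
        tauto
  · rw [StaysAboveEnd, hlen]
    refine forall₂_congr fun j hj => ?_
    rw [height_take _ _ _ (by omega), height_take _ _ _ hj]
  · rw [StaysAboveStart, List.length_drop]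
    constructor
    · intro h j hj hj'
      have := h (j - i) (by omega)
      rw [height_drop, Nat.add_sub_cancel' hj] at this
      omega
    · intro h j hj
      have := h (i + j) (by omega) (by omega)
      rw [height_drop]
      omega

lemma getD_append_last (l₁ l₂ : List (Bool × ℕ)) (h : l₂ ≠ []) :
    (l₁ ++ l₂).getD ((l₁ ++ l₂).length - 1) (false, 0) =
      l₂.getD (l₂.length - 1) (false, 0) := by
  have := List.length_pos_iff.2 h
  rw [List.length_append, List.getD_append_right _ _ _ _ (by omega)]
  congr 1
  omega

lemma IsWord.append {S T : Finset ℕ} {a b : ℕ} {l₁ l₂ : List (Bool × ℕ)} (hT : T ⊆ S)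
    (h₁ : IsWord T a l₁) (h₂ : IsWord (S \ T) b l₂) : IsWord S (a + b) (l₁ ++ l₂) where
  nodup := by
    rw [List.map_append, List.nodup_append']
    refine ⟨h₁.nodup, h₂.nodup, ?_⟩
    rw [List.disjoint_left]
    intro x hx hx'
    rw [← List.mem_toFinset, h₁.labels] at hx
    rw [← List.mem_toFinset, h₂.labels] at hx'
    exact (Finset.mem_sdiff.1 hx').2 hx
  labels := by
    rw [List.map_append, List.toFinset_append, h₁.labels, h₂.labels,
      Finset.union_sdiff_of_subset hT]
  last := by
    by_cases h : l₂ = []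
    · subst h; simpa using h₁.last
    · rw [getD_append_last _ _ h, h₂.last]
  count := by rw [List.countP_append, h₁.count, h₂.count]

lemma IsWord.left {S : Finset ℕ} {k : ℕ} {l₁ l₂ : List (Bool × ℕ)} (h : IsWord S k (l₁ ++ l₂))
    (hlast : (l₁.getD (l₁.length - 1) (false, 0)).1 = false) :
    IsWord (l₁.map Prod.snd).toFinset (l₁.countP Prod.fst) l₁ where
  nodup := by
    have := h.nodup
    rw [List.map_append, List.nodup_append'] at this
    exact this.1
  labels := rfl
  last := hlast
  count := rfl

lemma IsWord.right {S : Finset ℕ} {k : ℕ} {l₁ l₂ : List (Bool × ℕ)} (h : IsWord S k (l₁ ++ l₂)) :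
    IsWord (S \ (l₁.map Prod.snd).toFinset) (l₂.countP Prod.fst) l₂ where
  nodup := by
    have := h.nodup
    rw [List.map_append, List.nodup_append'] at this
    exact this.2.1
  labels := by
    have hd := h.nodup
    rw [List.map_append, List.nodup_append'] at hd
    rw [← h.labels, List.map_append, List.toFinset_append, Finset.union_sdiff_left,
      Finset.sdiff_eq_self_of_disjoint]
    rw [List.disjoint_toFinset_iff_disjoint]
    exact hd.2.2.symm
  last := by
    by_cases h0 : l₂ = []
    · subst h0; simp
    · rw [← getD_append_last l₁ l₂ h0, h.last]
  count := rfl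

/-- A word with a marked cut is a pair of words. -/
def cutEquiv (S : Finset ℕ) (k : ℕ) :
    (Σ l : {l // IsWord S k l}, {i // i ≤ l.1.length ∧ IsCut (l.1.take i) (l.1.drop i)}) ≃
      {x : List (Bool × ℕ) × List (Bool × ℕ) // IsWord S k (x.1 ++ x.2) ∧ IsCut x.1 x.2} where
  toFun x := ⟨(x.1.1.take x.2.1, x.1.1.drop x.2.1), by
    rw [List.take_append_drop]; exact ⟨x.1.2, x.2.2.2⟩⟩
  invFun y := ⟨⟨y.1.1 ++ y.1.2, y.2.1⟩, ⟨y.1.1.length, by simp, by simpa using y.2.2⟩⟩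
  left_inv := by
    rintro ⟨⟨l, hl⟩, ⟨i, hi, hc⟩⟩
    refine Sigma.subtype_ext ?_ ?_
    · simp
    · simpa using hi
  right_inv := by
    rintro ⟨⟨l₁, l₂⟩, h⟩
    simp

/-- The labels of the first part and the numbers of horizontal steps of both parts. -/
def cutData (S : Finset ℕ) (k : ℕ)
    (x : {x : List (Bool × ℕ) × List (Bool × ℕ) // IsWord S k (x.1 ++ x.2) ∧ IsCut x.1 x.2}) :
    S.powerset × Finset.HasAntidiagonal.antidiagonal k :=
  (⟨(x.1.1.map Prod.snd).toFinset, by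
    have h := x.2.1.labels
    rw [List.map_append, List.toFinset_append] at h
    exact Finset.mem_powerset.2 (Finset.union_subset_iff.1 h.subset).1⟩,
  ⟨(x.1.1.countP Prod.fst, x.1.2.countP Prod.fst), by
    have h := x.2.1.count
    rw [List.countP_append] at h
    exact Finset.HasAntidiagonal.mem_antidiagonal.2 h⟩)

/-- Once label sets and numbers of horizontal steps are fixed, the two parts are independent. -/
def cutDataFiberEquiv (S : Finset ℕ) (k : ℕ)
    (y : S.powerset × Finset.HasAntidiagonal.antidiagonal k) :
    {x // cutData S k x = y} ≃
      {l // IsWord y.1.1 y.2.1.1 l ∧ StaysAboveEnd l} ×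
        {l // IsWord (S \ y.1.1) y.2.1.2 l ∧ StaysAboveStart l} where
  toFun x := (⟨x.1.1.1, by
      obtain ⟨⟨x, h⟩, rfl⟩ := x
      exact ⟨h.1.left h.2.1, h.2.2.1⟩⟩, ⟨x.1.1.2, by
      obtain ⟨⟨x, h⟩, rfl⟩ := x
      exact ⟨h.1.right, h.2.2.2⟩⟩)
  invFun z := ⟨⟨(z.1.1, z.2.1), by
      have := z.1.2.1.append (Finset.mem_powerset.1 y.1.2) z.2.2.1
      rw [Finset.HasAntidiagonal.mem_antidiagonal.1 y.2.2] at this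
      exact ⟨this, z.1.2.1.last, z.1.2.2, z.2.2.2⟩⟩, by
      refine Prod.ext (Subtype.ext z.1.2.1.labels) (Subtype.ext ?_)
      exact Prod.ext z.1.2.1.count z.2.2.1.count⟩
  left_inv _ := rfl
  right_inv _ := rfl

lemma sum_positiveHorizCount_mul (n k : ℕ) (hn : 0 < n) :
    ∑ m ∈ Finset.range (n + 1), n.choose m * ∑ y ∈ Finset.HasAntidiagonal.antidiagonal k,
      positiveHorizCount m y.1 * positiveHorizCount (n - m) y.2 =
      2 * ((n - 1).choose k * n.factorial) := by
  set S := Finset.range n with hS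
  have hcard : S.card = n := by simp [hS]
  have hcut : ∀ l : {l // IsWord S k l},
      Nat.card {i // i ≤ l.1.length ∧ IsCut (l.1.take i) (l.1.drop i)} = 2 := by
    intro l
    rw [Nat.card_congr (Equiv.subtypeEquivRight (isCut_iff_isSplit l.2))]
    exact card_isSplit _ _ (by rw [l.2.length_eq, hcard]; exact hn) (height_step _)
  have hfin : ∀ l : {l // IsWord S k l},
      Finite {i // i ≤ l.1.length ∧ IsCut (l.1.take i) (l.1.drop i)} := fun l =>
    Nat.finite_of_card_ne_zero (by rw [hcut l]; norm_num)
  have := Fintype.ofFinite {l // IsWord S k l}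
  have hfin2 : Finite {x : List (Bool × ℕ) × List (Bool × ℕ) //
      IsWord S k (x.1 ++ x.2) ∧ IsCut x.1 x.2} := Finite.of_equiv _ (cutEquiv S k)
  have h1 : Nat.card {x : List (Bool × ℕ) × List (Bool × ℕ) //
      IsWord S k (x.1 ++ x.2) ∧ IsCut x.1 x.2} = 2 * ((n - 1).choose k * n.factorial) := by
    rw [← Nat.card_congr (cutEquiv S k), Nat.card_sigma, Finset.sum_congr rfl fun l _ => hcut l,
      Finset.sum_const, Finset.card_univ, ← Nat.card_eq_fintype_card, card_isWord, hcard,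
      smul_eq_mul, mul_comm]
  rw [← h1, Nat.card_congr (Equiv.sigmaFiberEquiv (cutData S k)).symm, Nat.card_sigma]
  have h2 : ∀ y : S.powerset × Finset.HasAntidiagonal.antidiagonal k,
      Nat.card {x // cutData S k x = y} = positiveHorizCount y.1.1.card y.2.1.1 *
        positiveHorizCount (n - y.1.1.card) y.2.1.2 := by
    intro y
    rw [Nat.card_congr (cutDataFiberEquiv S k y), Nat.card_prod, card_staysAboveEnd,
      card_staysAboveStart, Finset.card_sdiff_of_subset (Finset.mem_powerset.1 y.1.2), hcard]
  rw [Finset.sum_congr rfl fun y _ => h2 y, Fintype.sum_prod_type]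
  have h3 : ∀ T : S.powerset, ∑ a : Finset.HasAntidiagonal.antidiagonal k,
      positiveHorizCount T.1.card a.1.1 * positiveHorizCount (n - T.1.card) a.1.2 =
      ∑ y ∈ Finset.HasAntidiagonal.antidiagonal k,
        positiveHorizCount T.1.card y.1 * positiveHorizCount (n - T.1.card) y.2 := fun T =>
    Finset.sum_coe_sort _ (fun y : ℕ × ℕ =>
      positiveHorizCount T.1.card y.1 * positiveHorizCount (n - T.1.card) y.2)
  rw [Finset.sum_congr rfl fun T _ => h3 T, Finset.sum_coe_sort S.powerset (fun T =>
    ∑ y ∈ Finset.HasAntidiagonal.antidiagonal k,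
      positiveHorizCount T.card y.1 * positiveHorizCount (n - T.card) y.2),
    Finset.sum_powerset_apply_card (fun m => ∑ y ∈ Finset.HasAntidiagonal.antidiagonal k,
      positiveHorizCount m y.1 * positiveHorizCount (n - m) y.2), hcard]
  simp only [smul_eq_mul]

lemma positiveHorizCount_zero (k : ℕ) : positiveHorizCount 0 k = if k = 0 then 1 else 0 := by
  rw [positiveHorizCount]
  have hall : ∀ ps : (Fin (0 - 1) → ℤ) × Equiv.Perm (Fin 0),
      (IsPositivePath 0 ps.1 ps.2 ∧ horizCount 0 ps.1 = k) ↔ k = 0 := by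
    intro ps
    have h1 : horizCount 0 ps.1 = 0 := by
      rw [horizCount, Finset.card_eq_zero]
      exact Finset.eq_empty_of_forall_notMem fun i => i.elim0
    have h2 : IsPositivePath 0 ps.1 ps.2 := by
      refine ⟨fun i => i.elim0, fun i => i.elim0, fun j hj => ?_⟩
      rw [Nat.le_zero.1 hj, psum_zero]
    rw [h1]
    simp [h2, eq_comm]
  rw [Nat.card_congr (Equiv.subtypeEquivRight hall)]
  split_ifs with h
  · have : Unique (Fin (0 - 1) → ℤ) := inferInstanceAs (Unique (Fin 0 → ℤ))
    simp [h]
  · simp [h]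

lemma sum_positiveHorizCount_div (n k : ℕ) (hn : 0 < n) :
    ∑ x ∈ Finset.HasAntidiagonal.antidiagonal n, ∑ y ∈ Finset.HasAntidiagonal.antidiagonal k,
      (positiveHorizCount x.1 y.1 / x.1.factorial : ℚ) *
        (positiveHorizCount x.2 y.2 / x.2.factorial) = 2 * (n - 1).choose k := by
  have h := congrArg (Nat.cast (R := ℚ)) (sum_positiveHorizCount_mul n k hn)
  push_cast at h
  have hn0 : (n.factorial : ℚ) ≠ 0 := by exact_mod_cast n.factorial_ne_zero
  rw [← mul_assoc, ← div_eq_iff hn0] at h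
  rw [← h, Finset.Nat.sum_antidiagonal_eq_sum_range_succ_mk, Finset.sum_div]
  refine Finset.sum_congr rfl fun m hm => ?_
  have hm' : m ≤ n := by have := Finset.mem_range.1 hm; omega
  rw [Finset.mul_sum, Finset.sum_div]
  refine Finset.sum_congr rfl fun y _ => ?_
  rw [Nat.cast_choose ℚ hm']
  have h1 : (m.factorial : ℚ) ≠ 0 := by exact_mod_cast m.factorial_ne_zero
  have h2 : ((n - m).factorial : ℚ) ≠ 0 := by exact_mod_cast (n - m).factorial_ne_zero
  field_simp

lemma positiveHorizCount_eq (n k : ℕ) :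
    (positiveHorizCount n k : ℚ) = n.factorial * horizCoeff n k := by
  have hz : ∀ k, (positiveHorizCount 0 k / (0).factorial : ℚ) = horizCoeff 0 k := by
    intro k
    rw [positiveHorizCount_zero, horizCoeff]
    rcases k with _ | k <;> simp [pathCoeff_zero]
  have h := eq_of_convolution_square_eq (fun n k => positiveHorizCount n k / n.factorial)
    horizCoeff (by rw [hz]; simp [horizCoeff, pathCoeff_zero])
    (by simp [horizCoeff, pathCoeff_zero]) (fun n k => ?_) n k
  · have hn0 : (n.factorial : ℚ) ≠ 0 := by exact_mod_cast n.factorial_ne_zero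
    rw [← h]
    field_simp
  · rcases Nat.eq_zero_or_pos n with rfl | hn
    · simp only [Finset.HasAntidiagonal.antidiagonal_zero, Finset.sum_singleton, hz]
    · rw [sum_horizCoeff_mul n k hn]
      exact sum_positiveHorizCount_div n k hn

lemma positiveHorizCount_eq_pathNum (n k : ℕ) :
    positiveHorizCount n k =
      n.choose k * (n - 1).choose k * k.factorial * pathNum (n - k) := by
  have h := positiveHorizCount_eq n k
  rcases lt_or_ge n k with hk | hk
  · rw [horizCoeff_of_lt hk, mul_zero] at h
    rw [Nat.choose_eq_zero_of_lt hk]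
    simpa using h
  · rw [horizCoeff, pathCoeff, ← Nat.choose_mul_factorial_mul_factorial hk] at h
    have h2 : ((n - k).factorial : ℚ) ≠ 0 := by exact_mod_cast (n - k).factorial_ne_zero
    push_cast at h
    field_simp at h
    have h' : (positiveHorizCount n k : ℚ) =
        n.choose k * (n - 1).choose k * k.factorial * pathNum (n - k) := by
      rw [h]; ring
    exact_mod_cast h'

/-- The number of well-labelled positive paths of size `n` with exactly `k` horizontal
steps is `C(n,k)·C(n-1,k)·k!·[(n-k-1)!!]²` if `n-k` is even and
`C(n,k)·C(n-1,k)·k!·(n-k)!!·(n-k-2)!!` otherwise. -/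
theorem positive_count_horiz (n k : ℕ) :
    Nat.card {ps : (Fin (n - 1) → ℤ) × Equiv.Perm (Fin n) //
        IsPositivePath n ps.1 ps.2 ∧ horizCount n ps.1 = k} =
      if Even (n - k) then
        n.choose k * (n - 1).choose k * k.factorial * Nat.doubleFactorial (n - k - 1) ^ 2
      else
        n.choose k * (n - 1).choose k * k.factorial *
          Nat.doubleFactorial (n - k) * Nat.doubleFactorial (n - k - 2) := by
  have h := positiveHorizCount_eq_pathNum n k
  rw [positiveHorizCount, pathNum] at h
  rw [h]
  split_ifs <;> ring
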